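/- Suppose p_1,...,p_{2t+1} ∈ Z_2^r have pairwise pair distance at least 2t, and extend by p_i = p_{((i−1) mod (2t+1)) + 1} for i ≥ 2t+2. Then the encoding Enc(u) = (u, p_{w_p(u)+1}) is a function-correcting symbol-pair code for the pair weight function w_p on Z_2^k: for all u, u' with w_p(u) ≠ w_p(u'), d_p(Enc(u), Enc(u')) ≥ 2t+1. -/

import Mathlib

open scoped Classical

/-- The pair distance: Hamming distance of the cyclic symbol-pair read vectors. -/
def pairDist {n : ℕ} (x y : Fin n → ZMod 2) : ℕ :=
  (Finset.univ.filter fun i : Fin n =>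
    (x i, x (i + ⟨1 % n, Nat.mod_lt 1 i.pos⟩)) ≠ (y i, y (i + ⟨1 % n, Nat.mod_lt 1 i.pos⟩))).card

/-- The optimal redundancy `r_p^f(k,t)` of a function-correcting symbol-pair code for `f`:
the smallest `r` admitting an encoding `u ↦ (u, p u)` such that codewords of messages with
distinct function values have pair distance at least `2t+1`. -/
noncomputable def rp {α : Type*} (k t : ℕ) (f : (Fin k → ZMod 2) → α) : ℕ :=
  sInf {r : ℕ | ∃ p : (Fin k → ZMod 2) → Fin r → ZMod 2,
    ∀ u v : Fin k → ZMod 2, f u ≠ f v →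
      2 * t + 1 ≤ pairDist (Fin.append u (p u)) (Fin.append v (p v))}

/-- `N_p(D)`: smallest length `r` for which a `D`-irregular-pair-distance code exists. -/
noncomputable def Np {M : ℕ} (D : Fin M → Fin M → ℕ) : ℕ :=
  sInf {r : ℕ | ∃ p : Fin M → Fin r → ZMod 2, ∀ i j, D i j ≤ pairDist (p i) (p j)}

/-- `N_p(M,D)`: smallest length admitting `M` vectors with pairwise pair distance ≥ `D`. -/
noncomputable def NpConst (M D : ℕ) : ℕ :=
  sInf {r : ℕ | ∃ p : Fin M → Fin r → ZMod 2,
    Function.Injective p ∧ ∀ i j, i ≠ j → D ≤ pairDist (p i) (p j)}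

/-- The pair-distance matrix `D_f^{(1)}`. -/
noncomputable def Dmat1 {α : Type*} {k M : ℕ} (t : ℕ) (f : (Fin k → ZMod 2) → α)
    (u : Fin M → Fin k → ZMod 2) : Fin M → Fin M → ℕ :=
  fun i j => if f (u i) ≠ f (u j) then 2 * t - pairDist (u i) (u j) else 0

/-- The pair-distance matrix `D_f^{(2)}`. -/
noncomputable def Dmat2 {α : Type*} {k M : ℕ} (t : ℕ) (f : (Fin k → ZMod 2) → α)
    (u : Fin M → Fin k → ZMod 2) : Fin M → Fin M → ℕ :=
  fun i j => if f (u i) ≠ f (u j) then 2 * t + 2 - pairDist (u i) (u j) else 0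

/-- The pair weight `w_p(u) = d_p(u, 0)`. -/
noncomputable def pairWeight {k : ℕ} (u : Fin k → ZMod 2) : ℕ :=
  pairDist u (fun _ => 0)

theorem pairDist_eq_hammingDist {n : ℕ} (x y : Fin n → ZMod 2) :
    pairDist x y = hammingDist
      (fun i : Fin n => (x i, x (i + ⟨1 % n, Nat.mod_lt 1 i.pos⟩)))
      (fun i : Fin n => (y i, y (i + ⟨1 % n, Nat.mod_lt 1 i.pos⟩))) := by
  unfold pairDist hammingDist
  congr

theorem pairWeight_le_pairDist_add {n : ℕ} (x y : Fin n → ZMod 2) :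
    pairWeight x ≤ pairDist x y + pairWeight y := by
  simp only [pairWeight, pairDist_eq_hammingDist]
  exact hammingDist_triangle _ _ _

theorem pairDist_comm {n : ℕ} (x y : Fin n → ZMod 2) : pairDist x y = pairDist y x := by
  simp only [pairDist_eq_hammingDist]
  exact hammingDist_comm _ _

theorem two_le_pairDist {k : ℕ} (hk : 2 ≤ k) {x y : Fin k → ZMod 2} (h : x ≠ y) :
    2 ≤ pairDist x y := by
  obtain ⟨m, rfl⟩ : ∃ m, k = m + 2 := ⟨k - 2, by omega⟩
  obtain ⟨i, hi⟩ := Function.ne_iff.mp h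
  have one_eq : (⟨1 % (m + 2), Nat.mod_lt 1 i.pos⟩ : Fin (m + 2)) = 1 := rfl
  have hne : i ≠ i - 1 := by
    intro h1
    have h2 : (1 : Fin (m + 2)) = 0 := sub_eq_self.mp h1.symm
    exact one_ne_zero h2
  refine (Finset.card_pair hne).symm.trans_le (Finset.card_le_card ?_)
  intro j hj
  simp only [Finset.mem_insert, Finset.mem_singleton] at hj
  simp only [Finset.mem_filter, Finset.mem_univ, true_and, one_eq]
  rcases hj with rfl | rfl
  · exact fun h' => hi (congrArg Prod.fst h')
  · rw [sub_add_cancel]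
    exact fun h' => hi (congrArg Prod.snd h')

/-- The pair distance as a sum over consecutive positions and the wrap-around pair, in terms of a
predicate on `ℕ` marking the positions where the words differ. -/
theorem pairDist_eq_sum_range {m : ℕ} (x y : Fin (m + 1) → ZMod 2) (a : ℕ → Prop)
    (ha : ∀ i : Fin (m + 1), a i ↔ x i ≠ y i) :
    pairDist x y = (∑ i ∈ Finset.range m, if a i ∨ a (i + 1) then 1 else 0) +
      if a m ∨ a 0 then 1 else 0 := by
  unfold pairDist
  rw [Finset.card_filter, Fin.sum_univ_castSucc, Finset.sum_range]
  have key : ∀ i j : Fin (m + 1), (x i, x j) ≠ (y i, y j) ↔ a i ∨ a j := by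
    intro i j
    rw [ha, ha, Ne, Prod.mk.injEq]
    tauto
  have hlast : Fin.last m + (⟨1 % (m + 1), Nat.mod_lt 1 m.succ_pos⟩ : Fin (m + 1)) = 0 := by
    ext
    simp [Fin.val_add]
  congr 1
  · refine Finset.sum_congr rfl fun i _ => ?_
    have hs : i.castSucc + (⟨1 % (m + 1), Nat.mod_lt 1 m.succ_pos⟩ : Fin (m + 1)) = i.succ := by
      ext
      have := i.isLt
      simp only [Fin.val_add, Fin.val_castSucc, Fin.val_succ, Nat.add_mod_mod]
      exact Nat.mod_eq_of_lt (by omega)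
    rw [hs]
    exact if_congr (key _ _) rfl rfl
  · rw [hlast]
    exact if_congr (key _ _) rfl rfl

/-- The predicate on `ℕ` marking the positions where two words of length `n` differ. -/
def DiffersAt {n : ℕ} (x y : Fin n → ZMod 2) (i : ℕ) : Prop :=
  ∃ h : i < n, x ⟨i, h⟩ ≠ y ⟨i, h⟩

theorem differsAt_iff {n : ℕ} (x y : Fin n → ZMod 2) (i : Fin n) :
    DiffersAt x y i ↔ x i ≠ y i := by
  simp [DiffersAt]

theorem differsAt_append_left {m n : ℕ} (x x' : Fin m → ZMod 2) (y y' : Fin n → ZMod 2)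
    {i : ℕ} (hi : i < m) :
    DiffersAt (Fin.append x y) (Fin.append x' y') i ↔ DiffersAt x x' i := by
  have := differsAt_iff (Fin.append x y) (Fin.append x' y') (Fin.castAdd n ⟨i, hi⟩)
  rw [Fin.append_left, Fin.append_left] at this
  exact this.trans (differsAt_iff x x' ⟨i, hi⟩).symm

theorem differsAt_append_right {m n : ℕ} (x x' : Fin m → ZMod 2) (y y' : Fin n → ZMod 2)
    {i : ℕ} (hi : i < n) :
    DiffersAt (Fin.append x y) (Fin.append x' y') (m + i) ↔ DiffersAt y y' i := by
  have := differsAt_iff (Fin.append x y) (Fin.append x' y') (Fin.natAdd m ⟨i, hi⟩)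
  rw [Fin.append_right, Fin.append_right] at this
  exact this.trans (differsAt_iff y y' ⟨i, hi⟩).symm

/-- The pair distance of concatenated words: only the two wrap-around pairs change. -/
theorem pairDist_append {m s : ℕ} (x x' : Fin (m + 1) → ZMod 2) (y y' : Fin (s + 1) → ZMod 2) :
    pairDist (Fin.append x y) (Fin.append x' y') +
        ((if DiffersAt x x' m ∨ DiffersAt x x' 0 then 1 else 0) +
          if DiffersAt y y' s ∨ DiffersAt y y' 0 then 1 else 0) =
      pairDist x x' + pairDist y y' +
        ((if DiffersAt x x' m ∨ DiffersAt y y' 0 then 1 else 0) +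
          if DiffersAt y y' s ∨ DiffersAt x x' 0 then 1 else 0) := by
  have := @pairDist_eq_sum_range (m + 1 + s) (@Fin.append (m + 1) (s + 1) _ x y)
    (@Fin.append (m + 1) (s + 1) _ x' y') _
    (@differsAt_iff (m + 1 + (s + 1)) (Fin.append x y) (Fin.append x' y'))
  rw [pairDist_eq_sum_range x x' _ (differsAt_iff x x'),
    pairDist_eq_sum_range y y' _ (differsAt_iff y y'),
    this, Finset.sum_range_add, Finset.sum_range_succ]
  have hleft := fun {i : ℕ} (hi : i < m + 1) => differsAt_append_left x x' y y' hi
  have hright := fun {i : ℕ} (hi : i < s + 1) => differsAt_append_right x x' y y' hi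
  have hsum_left : ∀ i ∈ Finset.range m,
      (if DiffersAt (Fin.append x y) (Fin.append x' y') i ∨
        DiffersAt (Fin.append x y) (Fin.append x' y') (i + 1) then 1 else 0) =
      if DiffersAt x x' i ∨ DiffersAt x x' (i + 1) then 1 else 0 := by
    intro i hi
    rw [Finset.mem_range] at hi
    exact if_congr (or_congr (hleft (by omega)) (hleft (by omega))) rfl rfl
  have hsum_right : ∀ i ∈ Finset.range s,
      (if DiffersAt (Fin.append x y) (Fin.append x' y') (m + 1 + i) ∨
        DiffersAt (Fin.append x y) (Fin.append x' y') (m + 1 + i + 1) then 1 else 0) =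
      if DiffersAt y y' i ∨ DiffersAt y y' (i + 1) then 1 else 0 := by
    intro i hi
    rw [Finset.mem_range] at hi
    exact if_congr (or_congr (hright (by omega)) (hright (i := i + 1) (by omega))) rfl rfl
  rw [Finset.sum_congr rfl hsum_left, Finset.sum_congr rfl hsum_right]
  have h1 := hleft (i := m) (by omega)
  have h2 : DiffersAt (Fin.append x y) (Fin.append x' y') (m + 1) ↔ DiffersAt y y' 0 :=
    hright (i := 0) (by omega)
  have h3 := hright (i := s) (by omega)
  have h4 := hleft (i := 0) (by omega)
  simp only [h1, h2, h3, h4]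
  ring

theorem pairDist_add_pairDist_le_pairDist_append_add_one {m s : ℕ}
    (x x' : Fin (m + 1) → ZMod 2) (y y' : Fin (s + 1) → ZMod 2) :
    pairDist x x' + pairDist y y' ≤ pairDist (Fin.append x y) (Fin.append x' y') + 1 := by
  have h := pairDist_append x x' y y'
  split_ifs at h <;> first | omega | tauto

theorem pairDist_le_pairDist_append_self {k r : ℕ} (x x' : Fin k → ZMod 2)
    (y : Fin r → ZMod 2) :
    pairDist x x' ≤ pairDist (Fin.append x y) (Fin.append x' y) := by
  rcases r with _ | s
  · rw [Fin.append_right_nil x y rfl, Fin.append_right_nil x' y rfl]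
    exact le_rfl
  rcases k with _ | m
  · simp [pairDist]
  have h := pairDist_append x x' y y
  have hy : ∀ i, ¬ DiffersAt y y i := fun i ⟨_, hi⟩ => hi rfl
  simp only [hy, or_false, false_or] at h
  split_ifs at h <;> first | omega | tauto

theorem stmt_18 (k t r : ℕ) (hk : 2 ≤ k)
    (p : Fin (2 * t + 1) → Fin r → ZMod 2)
    (hp : ∀ i j, i ≠ j → 2 * t ≤ pairDist (p i) (p j)) :
    ∀ u u' : Fin k → ZMod 2, pairWeight u ≠ pairWeight u' →
      2 * t + 1 ≤ pairDist
        (Fin.append u (p ⟨pairWeight u % (2 * t + 1), Nat.mod_lt _ (by omega)⟩))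
        (Fin.append u' (p ⟨pairWeight u' % (2 * t + 1), Nat.mod_lt _ (by omega)⟩)) := by
  intro u u' hw
  have hne : u ≠ u' := fun h => hw (congrArg pairWeight h)
  by_cases hmod : pairWeight u % (2 * t + 1) = pairWeight u' % (2 * t + 1)
  · have hd : 2 * t + 1 ≤ pairDist u u' := by
      have h1 := pairWeight_le_pairDist_add u u'
      have h2 := pairWeight_le_pairDist_add u' u
      rw [pairDist_comm u' u] at h2
      rcases Nat.lt_or_gt_of_ne hw with hlt | hgt
      · have := Nat.le_of_dvd (by omega) ((Nat.modEq_iff_dvd' hlt.le).mp hmod)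
        omega
      · have := Nat.le_of_dvd (by omega) ((Nat.modEq_iff_dvd' hgt.le).mp hmod.symm)
        omega
    simp only [hmod]
    exact hd.trans (pairDist_le_pairDist_append_self _ _ _)
  · have hd := two_le_pairDist hk hne
    have hpd := hp ⟨pairWeight u % (2 * t + 1), Nat.mod_lt _ (by omega)⟩
      ⟨pairWeight u' % (2 * t + 1), Nat.mod_lt _ (by omega)⟩
      (fun h => hmod (congrArg Fin.val h))
    rcases r with _ | s
    · have ht : t = 0 := by
        simp [pairDist] at hpd
        exact hpd
      subst ht
      simp [Nat.mod_one] at hmod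
    · obtain ⟨m, rfl⟩ : ∃ m, k = m + 1 := ⟨k - 1, by omega⟩
      have := pairDist_add_pairDist_le_pairDist_append_add_one u u'
        (p ⟨pairWeight u % (2 * t + 1), Nat.mod_lt _ (by omega)⟩)
        (p ⟨pairWeight u' % (2 * t + 1), Nat.mod_lt _ (by omega)⟩)
      omega
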